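/- arXiv:2008.13741 — 3 statements merged into one kernel-verified Lean document; each statement's English description precedes it below -/
import Mathlib

section
/- Let n ≥ 3 and let f : {0,1}^n → {0,1} be a Boolean function such that P_k(f) = 1 − 1/2^k for some k with 0 < k < n. Then f is a nested canalizing function with exactly one layer, i.e., there exist b, α_1, …, α_n ∈ {0,1} such that f(x_1,…,x_n) = b ⊕ ∏_{i=1}^n (x_i ⊕ α_i), where ⊕ denotes addition modulo 2 and the product is taken in the field with two elements. -/
open Finset

/-- The input set `c` (a partial assignment of values to variables) collectively
canalizes the Boolean function `f`: some output value `b` is forced whenever all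
variables in the domain of `c` take the prescribed values. -/
def CanalizesOn {n : ℕ} (f : (Fin n → Bool) → Bool) (c : Fin n → Option Bool) : Prop :=
  ∃ b : Bool, ∀ x : Fin n → Bool, (∀ i : Fin n, ∀ a : Bool, c i = some a → x i = a) → f x = b

/-- `canalizingProportion n f k` = P_k(f): the number of canalizing k-sets divided by
the total number 2^k * C(n,k) of k-sets. A k-set is encoded as a partial assignment
`c : Fin n → Option Bool` which is `some` on exactly `k` coordinates. -/
noncomputable def canalizingProportion (n : ℕ) (f : (Fin n → Bool) → Bool) (k : ℕ) : ℝ :=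
  (Nat.card {c : Fin n → Option Bool //
      (Finset.univ.filter fun i => (c i).isSome).card = k ∧ CanalizesOn f c} : ℝ) /
    (2 ^ k * (n.choose k) : ℝ)

/-- `f` is a nested canalizing function with exactly one layer:
f(x) = b ⊕ ∏ i, (x i ⊕ α i), where the product over 𝔽₂ equals 1 iff x i ≠ α i for all i. -/
def NCFOneLayer {n : ℕ} (f : (Fin n → Bool) → Bool) : Prop :=
  ∃ (b : Bool) (α : Fin n → Bool),
    ∀ x : Fin n → Bool, f x = xor b (decide (∀ i : Fin n, x i ≠ α i))

open Classical in
/-- The set of `k`-sets on which `f` is not constant. -/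
noncomputable def nonCanSets {n : ℕ} (f : (Fin n → Bool) → Bool) (k : ℕ) :
    Finset (Fin n → Option Bool) :=
  univ.filter fun c => (univ.filter fun i => (c i).isSome).card = k ∧ ¬ CanalizesOn f c

open Classical in
/-- The one-variable extensions of `c` on which `f` is not constant. -/
noncomputable def goodExt {n : ℕ} (f : (Fin n → Bool) → Bool) (c : Fin n → Option Bool) :
    Finset (Fin n × Bool) :=
  univ.filter fun p => c p.1 = none ∧ ¬ CanalizesOn f (Function.update c p.1 (some p.2))

theorem card_total (n k : ℕ) :
    (univ.filter fun c : Fin n → Option Bool =>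
      (univ.filter fun i => (c i).isSome).card = k).card = 2 ^ k * n.choose k := by
  classical
  rw [Finset.card_eq_sum_card_fiberwise (f := fun c => univ.filter fun i => (c i).isSome)
    (t := powersetCard k univ)]
  · have : ∀ S ∈ powersetCard k (univ : Finset (Fin n)),
        ((univ.filter fun c : Fin n → Option Bool =>
          (univ.filter fun i => (c i).isSome).card = k).filter
            fun c => (univ.filter fun i => (c i).isSome) = S).card = 2 ^ k := by
      intro S hS
      have hS' : S.card = k := (mem_powersetCard.1 hS).2
      have : ((univ.filter fun c : Fin n → Option Bool =>
          (univ.filter fun i => (c i).isSome).card = k).filter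
            fun c => (univ.filter fun i => (c i).isSome) = S)
          = Fintype.piFinset (fun i => if i ∈ S then ({some true, some false} : Finset (Option Bool)) else {none}) := by
        ext c
        simp only [mem_filter, mem_univ, true_and, Fintype.mem_piFinset]
        constructor
        · rintro ⟨_, h⟩ i
          have := Finset.ext_iff.1 h i
          simp only [mem_filter, mem_univ, true_and] at this
          rcases hc : c i with _ | _ | _ <;> simp [hc] at this <;> simp [this]
        · intro h
          have h2 : (univ.filter fun i => (c i).isSome) = S := by
            ext i
            have := h i
            simp only [mem_filter, mem_univ, true_and]
            by_cases hi : i ∈ S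
            · simp [hi] at this
              rcases this with h | h <;> simp [h, hi]
            · simp [hi] at this
              simp [this, hi]
          exact ⟨by rw [h2, hS'], h2⟩
      rw [this, Fintype.card_piFinset]
      have : ∀ i, (if i ∈ S then ({some true, some false} : Finset (Option Bool)) else {none}).card
          = if i ∈ S then 2 else 1 := by
        intro i; split_ifs <;> rfl
      simp [this, Finset.prod_ite, hS']
    rw [Finset.sum_congr rfl this]
    simp [mul_comm]
  · intro c hc
    simpa [mem_powersetCard] using hc

/-- If both extensions at `i` are canalizing but `c` is not, all other extensions are not. -/
theorem dict_case {n : ℕ} {f : (Fin n → Bool) → Bool} {c : Fin n → Option Bool}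
    (hc : ¬ CanalizesOn f c) {i : Fin n} (_hi : c i = none)
    (h : ∀ a, CanalizesOn f (Function.update c i (some a))) {j : Fin n} (hj : c j = none)
    (hij : j ≠ i) (a : Bool) : ¬ CanalizesOn f (Function.update c j (some a)) := by
  rintro ⟨b, hb⟩
  apply hc
  refine ⟨b, fun x hx => ?_⟩
  obtain ⟨b', hb'⟩ := h (x i)
  have h1 : f x = b' := by
    apply hb'
    intro l v hl
    by_cases hli : l = i
    · subst hli; simpa using hl
    · rw [Function.update_of_ne hli] at hl; exact hx l v hl
  have h2 : f (Function.update x j a) = b' := by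
    apply hb'
    intro l v hl
    by_cases hli : l = i
    · subst hli
      rw [Function.update_of_ne hij.symm]
      simpa using hl
    · rw [Function.update_of_ne hli] at hl
      have : l ≠ j := by rintro rfl; simp [hj] at hl
      rw [Function.update_of_ne this]; exact hx l v hl
  have h3 : f (Function.update x j a) = b := by
    apply hb
    intro l v hl
    by_cases hlj : l = j
    · subst hlj; simpa using hl
    · rw [Function.update_of_ne hlj] at hl ⊢; exact hx l v hl
  rw [h1, ← h2, h3]

theorem goodExt_dict {n : ℕ} {f : (Fin n → Bool) → Bool} {c : Fin n → Option Bool}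
    (hc : ¬ CanalizesOn f c) {i : Fin n} (hi : c i = none)
    (h : ∀ a, CanalizesOn f (Function.update c i (some a))) :
    2 * ((univ.filter fun i => c i = none).card - 1) ≤ (goodExt f c).card := by
  classical
  have : ((univ.filter fun i => c i = none).erase i) ×ˢ (univ : Finset Bool) ⊆ goodExt f c := by
    rintro ⟨j, a⟩ hj
    simp only [mem_product, mem_erase, mem_filter, mem_univ, true_and, and_true] at hj
    simp only [goodExt, mem_filter, mem_univ, true_and]
    exact ⟨hj.2, dict_case hc hi h hj.2 hj.1 a⟩
  have := card_le_card this
  rw [card_product, card_erase_of_mem (by simp [hi])] at this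
  simpa [mul_comm] using this

theorem goodExt_card {n : ℕ} {f : (Fin n → Bool) → Bool} {c : Fin n → Option Bool}
    (hc : ¬ CanalizesOn f c) (h2 : 2 ≤ (univ.filter fun i => c i = none).card) :
    (univ.filter fun i => c i = none).card ≤ (goodExt f c).card := by
  classical
  by_cases h : ∃ i, c i = none ∧ ∀ a, CanalizesOn f (Function.update c i (some a))
  · obtain ⟨i, hi, h⟩ := h
    have := goodExt_dict hc hi h
    omega
  · push Not at h
    have hs : (univ.filter fun i => c i = none) ⊆ (goodExt f c).image Prod.fst := by
      intro i hi
      simp only [mem_filter, mem_univ, true_and] at hi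
      obtain ⟨a, ha⟩ := h i hi
      exact mem_image.2 ⟨(i, a), by simp [goodExt, hi, ha], rfl⟩
    exact (card_le_card hs).trans card_image_le

theorem none_card {n : ℕ} (c : Fin n → Option Bool) :
    (univ.filter fun i => (c i).isSome).card + (univ.filter fun i => c i = none).card = n := by
  have := Finset.card_filter_add_card_filter_not (s := (univ : Finset (Fin n))) (fun i => (c i).isSome)
  simpa using this

theorem ext_inj {n : ℕ} {c : Fin n → Option Bool} {p q : Fin n × Bool} (hp : c p.1 = none)
    (h : Function.update c p.1 (some p.2) = Function.update c q.1 (some q.2)) : p = q := by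
  have h1 := congrFun h p.1
  by_cases hpq : p.1 = q.1
  · rw [hpq] at h1
    simp at h1
    exact Prod.ext hpq h1
  · simp [Function.update_of_ne hpq, hp] at h1

theorem ext_mem {n : ℕ} {f : (Fin n → Bool) → Bool} {c : Fin n → Option Bool} {k : ℕ}
    (hc : (univ.filter fun i => (c i).isSome).card = k) {p : Fin n × Bool}
    (hp : p ∈ goodExt f c) : Function.update c p.1 (some p.2) ∈ nonCanSets f (k + 1) := by
  classical
  simp only [goodExt, mem_filter, mem_univ, true_and] at hp
  simp only [nonCanSets, mem_filter, mem_univ, true_and]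
  refine ⟨?_, hp.2⟩
  have : (univ.filter fun i => (Function.update c p.1 (some p.2) i).isSome)
      = insert p.1 (univ.filter fun i => (c i).isSome) := by
    ext l
    by_cases hl : l = p.1
    · subst hl; simp
    · simp [Function.update_of_ne hl, hl]
  rw [this, card_insert_of_notMem (by simp [hp.1]), hc]

theorem step {n : ℕ} (f : (Fin n → Bool) → Bool) (k : ℕ) (hk : k + 2 ≤ n) :
    (nonCanSets f k).card * (n - k) ≤ (nonCanSets f (k + 1)).card * (k + 1) := by
  classical
  apply Finset.card_mul_le_card_mul (fun c c' : Fin n → Option Bool =>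
    ∃ i, (c' i).isSome ∧ c = Function.update c' i none)
  · intro c hc
    simp only [nonCanSets, mem_filter, mem_univ, true_and] at hc
    have hn := none_card c
    have hg := goodExt_card hc.2 (by omega)
    have : (goodExt f c).card ≤ _ := Finset.card_le_card_of_injOn
      (t := bipartiteAbove (fun c c' : Fin n → Option Bool =>
        ∃ i, (c' i).isSome ∧ c = Function.update c' i none) (nonCanSets f (k+1)) c)
      (fun p => Function.update c p.1 (some p.2)) ?_ ?_
    · omega
    · intro p hp
      simp only [coe_bipartiteAbove, Set.mem_ofPred_eq]
      refine ⟨ext_mem hc.1 hp, p.1, by simp, ?_⟩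
      have hp' : c p.1 = none := by
        have := mem_coe.1 hp
        simp only [goodExt, mem_filter, mem_univ, true_and] at this
        exact this.1
      simp [← hp']
    · intro p hp q hq h
      have hp' : c p.1 = none := by
        have := mem_coe.1 hp
        simp only [goodExt, mem_filter, mem_univ, true_and] at this
        exact this.1
      exact ext_inj hp' h
  · intro c' hc'
    simp only [nonCanSets, mem_filter, mem_univ, true_and] at hc'
    have : bipartiteBelow (fun c c' : Fin n → Option Bool =>
        ∃ i, (c' i).isSome ∧ c = Function.update c' i none) (nonCanSets f k) c' ⊆
        (univ.filter fun i => (c' i).isSome).image (fun i => Function.update c' i none) := by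
      intro c hc
      obtain ⟨i, hi, h⟩ := (mem_bipartiteBelow _).1 hc |>.2
      exact mem_image.2 ⟨i, by simpa using hi, h.symm⟩
    exact (card_le_card this).trans (card_image_le.trans hc'.1.le)

theorem descend {n : ℕ} (f : (Fin n → Bool) → Bool) (k : ℕ) (hk : k + 1 < n)
    (h : (nonCanSets f (k + 1)).card ≤ n.choose (k + 1)) : (nonCanSets f 1).card ≤ n := by
  induction k with
  | zero => simpa using h
  | succ k ih =>
    apply ih (by omega)
    have h1 := step f (k + 1) (by omega)
    have h2 := Nat.choose_succ_right_eq n (k + 1)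
    have h3 : (nonCanSets f (k + 1)).card * (n - (k + 1)) ≤ n.choose (k + 1) * (n - (k + 1)) := by
      rw [← h2]
      exact h1.trans (Nat.mul_le_mul_right _ h)
    exact Nat.le_of_mul_le_mul_right h3 (by omega)

theorem final_step {n : ℕ} (hn : 3 ≤ n) (f : (Fin n → Bool) → Bool)
    (hf : ¬ CanalizesOn f (fun _ => none)) (h : (nonCanSets f 1).card ≤ n) : NCFOneLayer f := by
  classical
  have hg : (goodExt f (fun _ => none)).card ≤ n := by
    refine le_trans (Finset.card_le_card_of_injOn
      (fun p => Function.update (fun _ => none) p.1 (some p.2)) ?_ ?_) h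
    · intro p hp
      exact ext_mem (k := 0) (by simp) hp
    · intro p hp q hq h
      exact ext_inj rfl h
  have h1 : ∀ i, ∃ a, ¬ CanalizesOn f (Function.update (fun _ => none) i (some a)) := by
    intro i
    by_contra hcon
    push Not at hcon
    have := goodExt_dict hf (i := i) rfl hcon
    simp at this
    omega
  choose β hβ using h1
  have h2 : ∀ i, CanalizesOn f (Function.update (fun _ => none) i (some (!β i))) := by
    intro i
    by_contra hcon
    have hs : insert (i, !β i) (univ.image fun j => (j, β j)) ⊆ goodExt f (fun _ => none) := by
      intro p hp
      simp only [goodExt, mem_filter, mem_univ, true_and]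
      rcases mem_insert.1 hp with rfl | hp
      · exact hcon
      · obtain ⟨j, _, rfl⟩ := mem_image.1 hp
        exact hβ j
    have := card_le_card hs
    rw [card_insert_of_notMem, card_image_of_injective] at this
    · simp at this; omega
    · intro a b hab; exact (Prod.ext_iff.1 hab).1
    · simp
  choose b hb using h2
  have hb' : ∀ i x, x i = !β i → f x = b i := by
    intro i x hx
    apply hb
    intro l v hl
    by_cases hli : l = i
    · subst hli; simp at hl; rw [hx, hl, Bool.not_not]
    · simp [Function.update_of_ne hli] at hl
  have hbb : ∀ i, b i = f (fun j => !β j) := fun i => (hb' i _ rfl).symm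
  set B := f (fun j => !β j) with hB
  have hout : ∀ x, x ≠ β → f x = B := by
    intro x hx
    obtain ⟨i, hi⟩ := Function.ne_iff.1 hx
    rw [hb' i x (by cases h : x i <;> cases h' : β i <;> simp_all), hbb]
  have hin : f β ≠ B := by
    intro hcon
    apply hf
    refine ⟨B, fun x _ => ?_⟩
    by_cases hx : x = β
    · rw [hx, hcon]
    · exact hout x hx
  refine ⟨B, fun j => !β j, fun x => ?_⟩
  by_cases hx : x = β
  · subst hx
    simp
    cases h : f x <;> cases h' : B <;> simp_all
  · rw [hout x hx]
    have : ¬ ∀ i, x i ≠ !β i := by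
      intro hall
      apply hx
      funext i
      have := hall i
      cases h : x i <;> cases h' : β i <;> simp_all
    rw [decide_eq_false this, Bool.xor_false]

theorem NCFOneLayer_of_Pk_max (n : ℕ) (hn : 3 ≤ n) (f : (Fin n → Bool) → Bool)
    (h : ∃ k : ℕ, 0 < k ∧ k < n ∧ canalizingProportion n f k = 1 - 1 / 2 ^ k) :
    NCFOneLayer f := by
  classical
  obtain ⟨k, hk0, hkn, h⟩ := h
  have hch : 0 < n.choose k := Nat.choose_pos hkn.le
  have hN : (nonCanSets f k).card = n.choose k := by
    have ht := card_total n k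
    rw [← Finset.card_filter_add_card_filter_not (fun c => CanalizesOn f c),
      Finset.filter_filter, Finset.filter_filter] at ht
    unfold canalizingProportion at h
    rw [Nat.card_eq_fintype_card, Fintype.card_subtype] at h
    change _ + (nonCanSets f k).card = _ at ht
    have ht' := congrArg (Nat.cast : ℕ → ℝ) ht
    push_cast at ht'
    have hc' : (0 : ℝ) < n.choose k := by exact_mod_cast hch
    have h2 : (0 : ℝ) < 2 ^ k := by positivity
    rw [div_eq_iff (by positivity)] at h
    have h3 : (1 - 1 / 2 ^ k : ℝ) * (2 ^ k * n.choose k) = 2 ^ k * n.choose k - n.choose k := by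
      field_simp
    rw [h3] at h
    have : ((nonCanSets f k).card : ℝ) = n.choose k := by linarith
    exact_mod_cast this
  obtain ⟨k, rfl⟩ : ∃ m, k = m + 1 := ⟨k - 1, by omega⟩
  refine final_step hn f ?_ (descend f k hkn hN.le)
  rintro ⟨b, hb⟩
  have : nonCanSets f (k + 1) = ∅ := by
    ext c
    simp only [nonCanSets, mem_filter, mem_univ, true_and, notMem_empty, iff_false, not_and, not_not]
    intro _
    exact ⟨b, fun x _ => hb x (by simp)⟩
  rw [this] at hN
  simp at hN
  omega
end

section
/- Let n ≥ 2 and let f : {0,1}^n → {0,1} be a nested canalizing function with exactly one layer, i.e., there exist b, α_1, …, α_n ∈ {0,1} such that f(x_1,…,x_n) = b ⊕ ∏_{i=1}^n (x_i ⊕ α_i), where ⊕ denotes addition modulo 2 and the product is taken in the field with two elements (for example, the AND function f(x_1,…,x_n) = x_1 x_2 ⋯ x_n). Then the canalizing strength satisfies c(f) = 1. -/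
open Finset

/-- The canalizing strength of a Boolean function on `n` variables. -/
noncomputable def canalizingStrength (n : ℕ) (f : (Fin n → Bool) → Bool) : ℝ :=
  (1 / ((n : ℝ) - 1)) *
    ∑ k ∈ Finset.Icc 1 (n - 1), ((2 ^ k : ℝ) / ((2 ^ k : ℝ) - 1)) * canalizingProportion n f k

open scoped Classical in
lemma count_partial {n : ℕ} (T : Fin n → Finset Bool) (m k : ℕ) (hT : ∀ i, (T i).card = m) :
    (Finset.univ.filter fun c : Fin n → Option Bool =>
      (Finset.univ.filter fun i => (c i).isSome).card = k ∧
        ∀ i a, c i = some a → a ∈ T i).card = n.choose k * m ^ k := by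
  have h1 := Finset.card_eq_sum_card_fiberwise
    (f := fun c : Fin n → Option Bool => Finset.univ.filter fun i => (c i).isSome)
    (s := Finset.univ.filter fun c : Fin n → Option Bool =>
      (Finset.univ.filter fun i => (c i).isSome).card = k ∧
        ∀ i a, c i = some a → a ∈ T i)
    (t := Finset.powersetCard k Finset.univ) (by
      intro c hc
      simp only [Finset.coe_filter, Finset.mem_univ, true_and, Set.mem_setOf_eq] at hc
      simp [Finset.mem_powersetCard, hc.1])
  rw [h1]
  have h2 : ∀ S ∈ Finset.powersetCard k (Finset.univ : Finset (Fin n)),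
      ((Finset.univ.filter fun c : Fin n → Option Bool =>
      (Finset.univ.filter fun i => (c i).isSome).card = k ∧
        ∀ i a, c i = some a → a ∈ T i).filter
        fun c => (Finset.univ.filter fun i => (c i).isSome) = S).card = m ^ k := by
    intro S hS
    have hS' : S.card = k := (Finset.mem_powersetCard.1 hS).2
    have : ((Finset.univ.filter fun c : Fin n → Option Bool =>
      (Finset.univ.filter fun i => (c i).isSome).card = k ∧
        ∀ i a, c i = some a → a ∈ T i).filter
        fun c => (Finset.univ.filter fun i => (c i).isSome) = S) =
        Fintype.piFinset (fun i => if i ∈ S then (T i).map Function.Embedding.some else {none}) := by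
      ext c
      simp only [Finset.mem_filter, Finset.mem_univ, true_and, Fintype.mem_piFinset]
      constructor
      · rintro ⟨⟨-, h⟩, rfl⟩ i
        have := h i
        rcases hc : c i with _ | a
        · simp [hc]
        · simp [hc, this a hc]
      · intro h
        have hd : (Finset.univ.filter fun i => (c i).isSome) = S := by
          ext i
          have := h i
          by_cases hi : i ∈ S
          · simp only [hi, if_true, Finset.mem_map] at this
            obtain ⟨a, -, ha⟩ := this
            simp [hi, ← ha]
          · simp only [hi, if_false, Finset.mem_singleton] at this
            simp [hi, this]
        refine ⟨⟨by rw [hd, hS'], ?_⟩, hd⟩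
        intro i a hc
        have := h i
        by_cases hi : i ∈ S
        · simpa [hi, hc] using this
        · simp [hi, hc] at this
    rw [this, Fintype.card_piFinset]
    have : ∀ i, (if i ∈ S then (T i).map Function.Embedding.some else {none}).card
        = if i ∈ S then m else 1 := by
      intro i
      split_ifs <;> simp [hT]
    simp only [this]
    rw [Finset.prod_ite_mem]
    simp [hS']
  rw [Finset.sum_congr rfl h2]
  simp

lemma canalizes_iff {n : ℕ} (f : (Fin n → Bool) → Bool) (b : Bool) (α : Fin n → Bool)
    (hf : ∀ x : Fin n → Bool, f x = xor b (decide (∀ i : Fin n, x i ≠ α i)))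
    (c : Fin n → Option Bool)
    (hc : (Finset.univ.filter fun i => (c i).isSome).card < n) :
    CanalizesOn f c ↔ ¬ ∀ i a, c i = some a → a ∈ ({!(α i)} : Finset Bool) := by
  constructor
  · rintro ⟨v, hv⟩ h
    obtain ⟨j, hj⟩ : ∃ j, c j = none := by
      by_contra! hne
      have : (Finset.univ.filter fun i => (c i).isSome) = Finset.univ := by
        ext i
        simpa [Option.isSome_iff_ne_none] using hne i
      rw [this] at hc
      simp at hc
    have e1 := hv (fun i => !(α i)) (fun i a h' => by simpa using (Finset.mem_singleton.1 (h i a h')).symm)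
    have e2 := hv (Function.update (fun i => !(α i)) j (α j)) (fun i a h' => by
      have hij : i ≠ j := by
        rintro rfl
        simp [hj] at h'
      rw [Function.update_of_ne hij]
      simpa using (Finset.mem_singleton.1 (h i a h')).symm)
    rw [hf] at e1 e2
    have p1 : ∀ i, (!(α i)) ≠ α i := by simp
    have p2 : ¬ ∀ i, (Function.update (fun i => !(α i)) j (α j)) i ≠ α i := by
      intro h
      exact h j (by simp)
    rw [decide_eq_true p1] at e1
    rw [decide_eq_false p2] at e2
    rw [← e2] at e1
    cases b <;> simp at e1
  · intro h
    push Not at h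
    obtain ⟨i, a, hi, ha⟩ := h
    refine ⟨b, fun x hx => ?_⟩
    have : ¬ ∀ i, x i ≠ α i := by
      intro h
      apply h i
      rw [hx i a hi]
      simpa using ha
    rw [hf, decide_eq_false this]
    simp

open scoped Classical in
lemma proportion_eq {n : ℕ} (f : (Fin n → Bool) → Bool) (hf : NCFOneLayer f) (k : ℕ)
    (hk : k < n) :
    canalizingProportion n f k = ((2 : ℝ) ^ k - 1) / 2 ^ k := by
  obtain ⟨b, α, hf⟩ := hf
  have h1 := count_partial (n := n) (fun _ => Finset.univ) 2 k (by simp)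
  have h2 := count_partial (n := n) (fun i => {!(α i)}) 1 k (by simp)
  have h3 : Nat.card {c : Fin n → Option Bool //
      (Finset.univ.filter fun i => (c i).isSome).card = k ∧ CanalizesOn f c} + n.choose k
      = n.choose k * 2 ^ k := by
    rw [Nat.card_eq_fintype_card, Fintype.card_subtype, ← h1]
    simp only [one_pow, mul_one] at h2
    rw [← h2, ← Finset.card_union_of_disjoint]
    · congr 1
      ext c
      simp only [Finset.mem_union, Finset.mem_filter, Finset.mem_univ, true_and, implies_true,
        and_true]
      constructor
      · rintro (h | h) <;> exact h.1
      · intro h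
        rw [canalizes_iff f b α hf c (by omega)]
        tauto
    · rw [Finset.disjoint_left]
      intro c h h'
      simp only [Finset.mem_filter, Finset.mem_univ, true_and] at h h'
      exact (canalizes_iff f b α hf c (by omega)).1 h.2 h'.2
  have h4 : (0 : ℝ) < n.choose k := by exact_mod_cast Nat.choose_pos hk.le
  have h5 := congrArg (Nat.cast : ℕ → ℝ) h3
  push_cast at h5
  unfold canalizingProportion
  rw [eq_sub_of_add_eq h5]
  field_simp

theorem canalizingStrength_of_NCFOneLayer (n : ℕ) (hn : 2 ≤ n)
    (f : (Fin n → Bool) → Bool) (hf : NCFOneLayer f) :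
    canalizingStrength n f = 1 := by
  unfold canalizingStrength
  have h : ∀ k ∈ Finset.Icc 1 (n - 1),
      ((2 ^ k : ℝ) / ((2 ^ k : ℝ) - 1)) * canalizingProportion n f k = 1 := by
    intro k hk
    rw [Finset.mem_Icc] at hk
    rw [proportion_eq f hf k (by omega)]
    have h1 : (1 : ℝ) < 2 ^ k := one_lt_pow₀ (by norm_num) (by omega)
    have h2 : (2 : ℝ) ^ k - 1 ≠ 0 := by linarith
    field_simp
  rw [Finset.sum_congr rfl h]
  have h2 : (2 : ℝ) ≤ n := by exact_mod_cast hn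
  have h3 : (n : ℝ) - 1 ≠ 0 := by linarith
  simp only [Finset.sum_const, Nat.card_Icc, nsmul_eq_mul, mul_one]
  rw [Nat.add_sub_cancel, Nat.cast_sub (by omega)]
  field_simp
  simp
end

section
/- Let f : {0,1}^n → {0,1} be a uniformly random Boolean function (each of the 2^n output values is an independent fair coin flip). Then for every 0 ≤ k ≤ n, the expected k-set canalizing proportion satisfies E[P_k(f)] = 1/2^{2^{n−k}−1}. -/
open Finset

/-- The probability weight of the Boolean function `f` under the p-biased product
measure: each output value is independently 1 with probability `p`. -/
noncomputable def biasedWeight (n : ℕ) (p : ℝ) (f : (Fin n → Bool) → Bool) : ℝ :=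
  ∏ x : Fin n → Bool, (if f x then p else 1 - p)

open Classical in
lemma aux_subcube_card {n : ℕ} (c : Fin n → Option Bool) (k : ℕ)
    (hc : (Finset.univ.filter fun i => (c i).isSome).card = k) :
    (Finset.univ.filter fun x : Fin n → Bool =>
      ∀ i : Fin n, ∀ a : Bool, c i = some a → x i = a).card = 2 ^ (n - k) := by
  have h1 : (Finset.univ.filter fun x : Fin n → Bool =>
      ∀ i : Fin n, ∀ a : Bool, c i = some a → x i = a)
      = Fintype.piFinset (fun i => Finset.univ.filter fun y : Bool =>
          ∀ a : Bool, c i = some a → y = a) := by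
    ext x
    simp [Fintype.mem_piFinset]
  have h2 : ∀ i, (Finset.univ.filter fun y : Bool => ∀ a : Bool, c i = some a → y = a).card
      = if (c i).isSome then 1 else 2 := by
    intro i
    rcases c i with _ | a
    · simp
    · simp [Finset.filter_eq']
  rw [h1, Fintype.card_piFinset, Finset.prod_congr rfl (fun i _ => h2 i), Finset.prod_ite]
  simp only [Finset.prod_const, one_pow, one_mul]
  congr 1
  have h3 := Finset.card_filter_add_card_filter_not (s := (Finset.univ : Finset (Fin n)))
    (fun i => (c i).isSome = true)
  simp only [Finset.card_univ, Fintype.card_fin] at h3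
  omega

open Classical in
lemma aux_const_card {α : Type*} [Fintype α] (S : Finset α) (b : Bool) :
    (Finset.univ.filter fun f : α → Bool => ∀ x ∈ S, f x = b).card
      = 2 ^ (Fintype.card α - S.card) := by
  have h1 : (Finset.univ.filter fun f : α → Bool => ∀ x ∈ S, f x = b)
      = Fintype.piFinset (fun x => if x ∈ S then {b} else Finset.univ) := by
    ext f
    simp only [Finset.mem_filter, Finset.mem_univ, true_and, Fintype.mem_piFinset]
    refine forall_congr' fun x => ?_
    by_cases h : x ∈ S <;> simp [h]
  have h2 : ∀ x, (if x ∈ S then ({b} : Finset Bool) else Finset.univ).card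
      = if x ∈ S then 1 else 2 := by
    intro x
    by_cases h : x ∈ S <;> simp [h]
  rw [h1, Fintype.card_piFinset, Finset.prod_congr rfl (fun i _ => h2 i), Finset.prod_ite]
  simp only [Finset.prod_const, one_pow, one_mul]
  congr 1
  rw [← Finset.card_compl]
  congr 1
  ext x
  simp

open Classical in
lemma aux_canalizing_card {n : ℕ} (c : Fin n → Option Bool) (k : ℕ)
    (hc : (Finset.univ.filter fun i => (c i).isSome).card = k) :
    (Finset.univ.filter fun f : (Fin n → Bool) → Bool => CanalizesOn f c).card
      = 2 * 2 ^ (2 ^ n - 2 ^ (n - k)) := by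
  have hS := aux_subcube_card c k hc
  set S := Finset.univ.filter fun x : Fin n → Bool =>
      ∀ i : Fin n, ∀ a : Bool, c i = some a → x i = a with hSdef
  have hne : S.Nonempty := by
    rw [← Finset.card_pos, hS]
    positivity
  obtain ⟨x₀, hx₀⟩ := hne
  have h1 : (Finset.univ.filter fun f : (Fin n → Bool) → Bool => CanalizesOn f c)
      = (Finset.univ.filter fun f : (Fin n → Bool) → Bool => ∀ x ∈ S, f x = true)
        ∪ (Finset.univ.filter fun f : (Fin n → Bool) → Bool => ∀ x ∈ S, f x = false) := by
    ext f
    simp only [Finset.mem_filter, Finset.mem_univ, true_and, Finset.mem_union, CanalizesOn, hSdef,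
      Bool.exists_bool]
    exact or_comm
  have h2 : ∀ b : Bool, (Finset.univ.filter fun f : (Fin n → Bool) → Bool =>
      ∀ x ∈ S, f x = b).card = 2 ^ (2 ^ n - 2 ^ (n - k)) := by
    intro b
    have h3 := aux_const_card S b
    rw [hS] at h3
    simp only [Fintype.card_fun, Fintype.card_bool, Fintype.card_fin] at h3
    rw [← h3]
    congr!
  rw [h1, Finset.card_union_of_disjoint, h2, h2]
  · ring
  · rw [Finset.disjoint_left]
    intro f hf hf2
    simp only [Finset.mem_filter, Finset.mem_univ, true_and] at hf hf2
    have := hf x₀ hx₀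
    rw [hf2 x₀ hx₀] at this
    cases this

open Classical in
lemma aux_ksets_card (n k : ℕ) :
    (Finset.univ.filter fun c : Fin n → Option Bool =>
      (Finset.univ.filter fun i => (c i).isSome).card = k).card = 2 ^ k * n.choose k := by
  rw [Finset.card_eq_sum_card_fiberwise
    (f := fun c : Fin n → Option Bool => Finset.univ.filter fun i => (c i).isSome)
    (t := Finset.powersetCard k Finset.univ)]
  · rw [Finset.sum_congr rfl (g := fun _ => 2 ^ k)]
    · simp [Finset.card_powersetCard, mul_comm]
    · intro T hT
      have hT' := (Finset.mem_powersetCard.1 hT).2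
      have h1 : ((Finset.univ.filter fun c : Fin n → Option Bool =>
          (Finset.univ.filter fun i => (c i).isSome).card = k).filter fun c =>
            (Finset.univ.filter fun i => (c i).isSome) = T)
          = Fintype.piFinset (fun i => if i ∈ T then ({some true, some false} : Finset (Option Bool))
              else {none}) := by
        ext c
        simp only [Finset.mem_filter, Finset.mem_univ, true_and, Fintype.mem_piFinset]
        have : ∀ i, (c i ∈ (if i ∈ T then ({some true, some false} : Finset (Option Bool))
              else {none})) ↔ ((c i).isSome ↔ i ∈ T) := by
          intro i
          by_cases h : i ∈ T <;> rcases c i with _ | _ | _ <;> simp [h]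
        simp only [this]
        constructor
        · rintro ⟨_, rfl⟩ i
          simp
        · intro h
          have : (Finset.univ.filter fun i => (c i).isSome) = T := by
            ext i
            simp [h i]
          exact ⟨by rw [this, hT'], this⟩
      have h2 : ∀ i, (if i ∈ T then ({some true, some false} : Finset (Option Bool))
              else {none}).card = if i ∈ T then 2 else 1 := by
        intro i
        by_cases h : i ∈ T <;> simp [h]
      rw [h1, Fintype.card_piFinset, Finset.prod_congr rfl (fun i _ => h2 i), Finset.prod_ite]
      simp [hT']
  · intro c hc
    simp at hc ⊢
    exact hc

lemma aux_weight (n : ℕ) (f : (Fin n → Bool) → Bool) :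
    biasedWeight n (1 / 2) f = (1 / 2) ^ (2 ^ n) := by
  unfold biasedWeight
  have : ∀ x, (if f x then (1 / 2 : ℝ) else 1 - 1 / 2) = 1 / 2 := by
    intro x
    split_ifs <;> norm_num
  rw [Finset.prod_congr rfl (fun x _ => this x)]
  simp

theorem expected_Pk_uniform (n k : ℕ) (hk : k ≤ n) :
    ∑ f : (Fin n → Bool) → Bool,
        biasedWeight n (1 / 2) f * canalizingProportion n f k
      = 1 / 2 ^ (2 ^ (n - k) - 1) := by
  classical
  have hcard : ∀ f : (Fin n → Bool) → Bool,
      (Nat.card {c : Fin n → Option Bool //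
        (Finset.univ.filter fun i => (c i).isSome).card = k ∧ CanalizesOn f c})
      = ∑ c ∈ Finset.univ.filter (fun c : Fin n → Option Bool =>
          (Finset.univ.filter fun i => (c i).isSome).card = k),
          if CanalizesOn f c then 1 else 0 := by
    intro f
    rw [Nat.card_eq_fintype_card, Fintype.card_subtype, ← Finset.filter_filter,
      Finset.card_filter]
  have htot : ∑ f : (Fin n → Bool) → Bool, (Nat.card {c : Fin n → Option Bool //
        (Finset.univ.filter fun i => (c i).isSome).card = k ∧ CanalizesOn f c})
      = (2 ^ k * n.choose k) * (2 * 2 ^ (2 ^ n - 2 ^ (n - k))) := by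
    rw [Finset.sum_congr rfl (fun f _ => hcard f), Finset.sum_comm,
      Finset.sum_congr rfl (g := fun _ => 2 * 2 ^ (2 ^ n - 2 ^ (n - k)))]
    · rw [Finset.sum_const, aux_ksets_card, smul_eq_mul]
    · intro c hc
      rw [← Finset.card_filter]
      exact aux_canalizing_card c k (Finset.mem_filter.1 hc).2
  have htotR := congrArg (Nat.cast : ℕ → ℝ) htot
  push_cast at htotR
  simp only [aux_weight, canalizingProportion]
  rw [← Finset.mul_sum, ← Finset.sum_div, htotR]
  have hch : (n.choose k : ℝ) ≠ 0 := by
    exact_mod_cast (Nat.choose_pos hk).ne'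
  rw [mul_div_cancel_left₀ _ (by positivity)]
  have hle : 2 ^ (n - k) ≤ 2 ^ n := Nat.pow_le_pow_right (by norm_num) (Nat.sub_le n k)
  have hpos : 1 ≤ 2 ^ (n - k) := Nat.one_le_two_pow
  generalize 2 ^ (n - k) = m at *
  generalize 2 ^ n = N at *
  obtain ⟨d, rfl⟩ := Nat.exists_eq_add_of_le hle
  obtain ⟨e, rfl⟩ := Nat.exists_eq_add_of_le hpos
  rw [Nat.add_sub_cancel_left, Nat.add_sub_cancel_left, one_div, one_div, inv_pow]
  field_simp
  ring
end
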